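/- arXiv:1509.09158 — 3 statements merged into one kernel-verified Lean document; each statement's English description precedes it below -/
import Mathlib

section
/- Let (V,B) be a 3-(v,k,λ_3)_q design admitting a tactical decomposition with point classes V_1,…,V_m, block classes B_1,…,B_n and tactical decomposition matrices [ρ_ij], [κ_ij], and let P be a point in V_l. Then ∑_{j=1}^n ρ_lj · κ_rj · κ_sj = λ_1 + Λ_ll(P)·λ_2 + (|V_l|² − Λ_ll(P) − 1)·λ_3 if l = r = s, and ∑_{j=1}^n ρ_lj · κ_rj · κ_sj = Λ_rs(P)·λ_2 + (|V_r|·|V_s| − Λ_rs(P))·λ_3 otherwise. -/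
/-- `Λ_rs(P)`: the number of pairs `(R,S) ∈ V_r × V_s` of points with
`dim ⟨P, R, S⟩ = 2`. -/
noncomputable def LambdaPt {Fq : Type} [Field Fq] {v : ℕ}
    (Vr Vs : Set (Submodule Fq (Fin v → Fq)))
    (P : Submodule Fq (Fin v → Fq)) : ℕ :=
  {RS : Submodule Fq (Fin v → Fq) × Submodule Fq (Fin v → Fq) |
    RS.1 ∈ Vr ∧ RS.2 ∈ Vs ∧ Module.finrank Fq ↥(P ⊔ RS.1 ⊔ RS.2) = 2}.ncard

/-- Double counting of the triples `(b, R, S)` with `p, R, S ≤ b`, where `b` ranges over a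
partitioned set of blocks and the numbers of incidences are constant on the parts. -/
theorem sum_mul_mul_eq_sum_product_card {α : Type*} [SemilatticeSup α] [DecidableEq α]
    [DecidableLE α] {n : ℕ} (B X Y : Finset α) (C : Fin n → Finset α) (p : α)
    (a x y : Fin n → ℕ) (hCsub : ∀ j, C j ⊆ B) (hC : ∀ b ∈ B, ∃! j, b ∈ C j)
    (ha : ∀ j, ((C j).filter (p ≤ ·)).card = a j)
    (hx : ∀ j, ∀ b ∈ C j, (X.filter (· ≤ b)).card = x j)
    (hy : ∀ j, ∀ b ∈ C j, (Y.filter (· ≤ b)).card = y j) :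
    ∑ j, a j * x j * y j =
      ∑ z ∈ X ×ˢ Y, (B.filter (p ⊔ z.1 ⊔ z.2 ≤ ·)).card := by
  have hpart : B.filter (p ≤ ·) = Finset.univ.biUnion fun j => (C j).filter (p ≤ ·) := by
    ext b
    simp only [Finset.mem_filter, Finset.mem_biUnion, Finset.mem_univ, true_and]
    constructor
    · rintro ⟨hb, hpb⟩
      obtain ⟨j, hj, -⟩ := hC b hb
      exact ⟨j, hj, hpb⟩
    · rintro ⟨j, hj, hpb⟩
      exact ⟨hCsub j hj, hpb⟩
  have hdisj : Set.PairwiseDisjoint (↑(Finset.univ : Finset (Fin n)))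
      fun j => (C j).filter (p ≤ ·) := by
    intro i _ j _ hij
    refine Finset.disjoint_left.2 fun b hbi hbj => hij ?_
    have hi := (Finset.mem_filter.1 hbi).1
    exact (hC b (hCsub i hi)).unique hi (Finset.mem_filter.1 hbj).1
  have hsplit : ∀ z ∈ X ×ˢ Y, (B.filter (p ⊔ z.1 ⊔ z.2 ≤ ·)).card =
      ((B.filter (p ≤ ·)).filter fun b => z.1 ≤ b ∧ z.2 ≤ b).card := by
    intro z _
    rw [Finset.filter_filter]
    simp only [sup_le_iff, and_assoc]
  have hswap := Finset.sum_card_bipartiteAbove_eq_sum_card_bipartiteBelow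
    (s := X ×ˢ Y) (t := B.filter (p ≤ ·)) (fun (z : α × α) b => z.1 ≤ b ∧ z.2 ≤ b)
  simp only [Finset.bipartiteAbove, Finset.bipartiteBelow] at hswap
  rw [Finset.sum_congr rfl hsplit, hswap, hpart, Finset.sum_biUnion hdisj]
  refine Finset.sum_congr rfl fun j _ => ?_
  rw [Finset.sum_const_nat (m := x j * y j), ha, mul_assoc]
  intro b hb
  have hb := (Finset.mem_filter.1 hb).1
  rw [← hx j b hb, ← hy j b hb, ← Finset.card_product, ← Finset.filter_product]

/-- A sum over a finite set of a function which is `c₁`, `c₂` or `c₃` according to a label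
in `{1, 2, 3}`. -/
theorem sum_eq_of_label {β : Type*} (A : Finset β) (d f : β → ℕ) (c₁ c₂ c₃ : ℕ)
    (hd : ∀ z ∈ A, d z = 1 ∧ f z = c₁ ∨ d z = 2 ∧ f z = c₂ ∨ d z = 3 ∧ f z = c₃) :
    ∑ z ∈ A, f z = (A.filter (d · = 1)).card * c₁ + (A.filter (d · = 2)).card * c₂ +
      (A.card - (A.filter (d · = 2)).card - (A.filter (d · = 1)).card) * c₃ := by
  have hcard : A.card = (A.filter (d · = 1)).card + (A.filter (d · = 2)).card +
      (A.filter (d · = 3)).card := by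
    simp only [Finset.card_filter, ← Finset.sum_add_distrib]
    rw [Finset.card_eq_sum_ones]
    refine Finset.sum_congr rfl fun z hz => ?_
    rcases hd z hz with h | h | h <;> simp [h.1]
  rw [show A.card - (A.filter (d · = 2)).card - (A.filter (d · = 1)).card =
    (A.filter (d · = 3)).card by omega]
  simp only [Finset.card_filter, Finset.sum_mul, ← Finset.sum_add_distrib]
  refine Finset.sum_congr rfl fun z hz => ?_
  rcases hd z hz with h | h | h <;> simp [h.1, h.2]

/-- The span of three points has dimension `1`, `2` or `3`, and it has dimension `1` exactly
when the points coincide. -/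
theorem finrank_sup_sup_of_points {K V : Type*} [Field K] [AddCommGroup V] [Module K V]
    [FiniteDimensional K V] {P R S : Submodule K V} (hP : Module.finrank K P = 1)
    (hR : Module.finrank K R = 1) (hS : Module.finrank K S = 1) :
    (Module.finrank K ↥(P ⊔ R ⊔ S) = 1 ∨ Module.finrank K ↥(P ⊔ R ⊔ S) = 2 ∨
      Module.finrank K ↥(P ⊔ R ⊔ S) = 3) ∧
    (Module.finrank K ↥(P ⊔ R ⊔ S) = 1 ↔ R = P ∧ S = P) := by
  have h₁ := Submodule.finrank_add_le_finrank_add_finrank P R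
  have h₂ := Submodule.finrank_add_le_finrank_add_finrank (P ⊔ R) S
  have h₃ : Module.finrank K P ≤ Module.finrank K ↥(P ⊔ R ⊔ S) :=
    Submodule.finrank_mono (le_sup_left.trans le_sup_left)
  refine ⟨by omega, fun h => ?_, ?_⟩
  · have hPe : P = P ⊔ R ⊔ S :=
      Submodule.eq_of_le_of_finrank_eq (le_sup_left.trans le_sup_left) (hP.trans h.symm)
    have hRe : R = P ⊔ R ⊔ S :=
      Submodule.eq_of_le_of_finrank_eq (le_sup_right.trans le_sup_left) (hR.trans h.symm)
    have hSe : S = P ⊔ R ⊔ S :=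
      Submodule.eq_of_le_of_finrank_eq le_sup_right (hS.trans h.symm)
    exact ⟨hRe.trans hPe.symm, hSe.trans hPe.symm⟩
  · rintro ⟨rfl, rfl⟩
    rwa [sup_idem, sup_idem]

/-- For a `3`-`(v,k,λ₃)_q` design with a tactical decomposition and a
point `P ∈ V_l`,
`∑_j ρ_lj κ_rj κ_sj = λ₁ + Λ_ll(P)·λ₂ + (|V_l|² − Λ_ll(P) − 1)·λ₃` if `l = r = s`,
and `= Λ_rs(P)·λ₂ + (|V_r|·|V_s| − Λ_rs(P))·λ₃` otherwise. -/
theorem tactical_decomposition_third_equations_pointwise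
    (q v k l3 l2 l1 : ℕ) (Fq : Type) [Field Fq] [Fintype Fq]
    (hq : Fintype.card Fq = q)
    (hvk : k < v) (hk : 1 < k) (hkt : 3 ≤ k) (hl3 : 1 ≤ l3)
    (B : Set (Submodule Fq (Fin v → Fq)))
    (hBdim : ∀ b ∈ B, Module.finrank Fq ↥b = k)
    (hdesign : ∀ T : Submodule Fq (Fin v → Fq), Module.finrank Fq ↥T = 3 →
      {b ∈ B | T ≤ b}.ncard = l3)
    (hl2 : ∀ T : Submodule Fq (Fin v → Fq), Module.finrank Fq ↥T = 2 →
      {b ∈ B | T ≤ b}.ncard = l2)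
    (hl1 : ∀ P : Submodule Fq (Fin v → Fq), Module.finrank Fq ↥P = 1 →
      {b ∈ B | P ≤ b}.ncard = l1)
    (m n : ℕ)
    (Vc : Fin m → Set (Submodule Fq (Fin v → Fq)))
    (Bc : Fin n → Set (Submodule Fq (Fin v → Fq)))
    (hVpts : ∀ i, ∀ P ∈ Vc i, Module.finrank Fq ↥P = 1)
    (hVpart : ∀ P : Submodule Fq (Fin v → Fq), Module.finrank Fq ↥P = 1 → ∃! i, P ∈ Vc i)
    (hBsub : ∀ j, Bc j ⊆ B)
    (hBpart : ∀ b ∈ B, ∃! j, b ∈ Bc j)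
    (ρ κ : Fin m → Fin n → ℕ)
    (hρ : ∀ i j, ∀ P ∈ Vc i, {b ∈ Bc j | P ≤ b}.ncard = ρ i j)
    (hκ : ∀ i j, ∀ b ∈ Bc j, {P ∈ Vc i | P ≤ b}.ncard = κ i j)
    (l : Fin m) (P : Submodule Fq (Fin v → Fq)) (hP : P ∈ Vc l) :
    ∀ r s : Fin m,
      ∑ j, ρ l j * κ r j * κ s j =
        if r = l ∧ s = l then
          l1 + LambdaPt (Vc l) (Vc l) P * l2 +
            ((Vc l).ncard ^ 2 - LambdaPt (Vc l) (Vc l) P - 1) * l3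
        else
          LambdaPt (Vc r) (Vc s) P * l2 +
            ((Vc r).ncard * (Vc s).ncard - LambdaPt (Vc r) (Vc s) P) * l3 := by
  classical
  intro r s
  have : Fintype (Submodule Fq (Fin v → Fq)) := Fintype.ofFinite _
  have hPd := hVpts l P hP
  have hcount := sum_mul_mul_eq_sum_product_card B.toFinset (Vc r).toFinset (Vc s).toFinset
    (fun j => (Bc j).toFinset) P (ρ l) (κ r) (κ s)
    (fun j => by simpa using hBsub j) (by simpa using hBpart)
    (fun j => by
      rw [← hρ l j P hP, ← Set.ncard_coe_finset]
      simp)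
    (fun j b hb => by
      rw [← hκ r j b (by simpa using hb), ← Set.ncard_coe_finset]
      simp)
    (fun j b hb => by
      rw [← hκ s j b (by simpa using hb), ← Set.ncard_coe_finset]
      simp)
  have hblocks : ∀ T : Submodule Fq (Fin v → Fq),
      (B.toFinset.filter (T ≤ ·)).card = {b ∈ B | T ≤ b}.ncard := by
    intro T
    rw [← Set.ncard_coe_finset]
    simp
  have hlabel := sum_eq_of_label ((Vc r).toFinset ×ˢ (Vc s).toFinset)
    (fun z => Module.finrank Fq ↥(P ⊔ z.1 ⊔ z.2))
    (fun z => (B.toFinset.filter (P ⊔ z.1 ⊔ z.2 ≤ ·)).card) l1 l2 l3 (by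
      intro z hz
      simp only [Finset.mem_product, Set.mem_toFinset] at hz
      simp only [hblocks]
      rcases (finrank_sup_sup_of_points hPd (hVpts r _ hz.1) (hVpts s _ hz.2)).1 with h | h | h
      · exact Or.inl ⟨h, hl1 _ h⟩
      · exact Or.inr (Or.inl ⟨h, hl2 _ h⟩)
      · exact Or.inr (Or.inr ⟨h, hdesign _ h⟩))
  have hLambda : (((Vc r).toFinset ×ˢ (Vc s).toFinset).filter
      fun z => Module.finrank Fq ↥(P ⊔ z.1 ⊔ z.2) = 2).card = LambdaPt (Vc r) (Vc s) P := by
    rw [LambdaPt, ← Set.ncard_coe_finset]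
    simp [and_assoc]
  have hone : (((Vc r).toFinset ×ˢ (Vc s).toFinset).filter
      fun z => Module.finrank Fq ↥(P ⊔ z.1 ⊔ z.2) = 1) =
      if r = l ∧ s = l then {(P, P)} else ∅ := by
    have hmem : ∀ i, P ∈ Vc i ↔ i = l := fun i =>
      ⟨fun h => (hVpart P hPd).unique h hP, fun h => h ▸ hP⟩
    ext ⟨R, S⟩
    simp only [Finset.mem_filter, Finset.mem_product, Set.mem_toFinset]
    trans (r = l ∧ s = l) ∧ R = P ∧ S = P
    · constructor
      · rintro ⟨⟨hR, hS⟩, h⟩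
        obtain ⟨rfl, rfl⟩ := (finrank_sup_sup_of_points hPd (hVpts r _ hR) (hVpts s _ hS)).2.1 h
        exact ⟨⟨(hmem r).1 hR, (hmem s).1 hS⟩, rfl, rfl⟩
      · rintro ⟨⟨rfl, rfl⟩, rfl, rfl⟩
        exact ⟨⟨hP, hP⟩, (finrank_sup_sup_of_points hPd hPd hPd).2.2 ⟨rfl, rfl⟩⟩
    · split_ifs with h <;> simp [h]
  rw [hcount, hlabel, hLambda, hone, Finset.card_product, ← Set.ncard_eq_toFinset_card',
    ← Set.ncard_eq_toFinset_card']
  split_ifs with h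
  · obtain ⟨rfl, rfl⟩ := h
    simp [sq]
  · simp
end

section
/- Let (V,B) be a 3-(v,k,λ_3)_q design admitting a tactical decomposition with point classes V_1,…,V_m and block classes B_1,…,B_n. Then for all l, r, s ∈ {1,…,m}, the value Λ_rs(P) is independent of the choice of the point P ∈ V_l; that is, Λ_rs(P) = Λ_rs(P') for all points P, P' ∈ V_l. -/
open Finset Module in
/-- In a finite space, if every `(t+1)`-dimensional subspace lies in exactly `lam ≥ 1` members of a
family of `k`-dimensional subspaces, then every `t`-dimensional subspace lies in the same number of
members, and this number is larger than `lam`. -/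
theorem exists_card_filter_le_eq_of_finrank_succ {K V : Type*} [Field K] [Finite K] [AddCommGroup V]
    [Module K V] [Module.Finite K V] [DecidableLE (Submodule K V)] {B : Finset (Submodule K V)}
    {t k lam : ℕ} (htk : t < k) (hkV : k < finrank K V) (hlam : 0 < lam)
    (hB : ∀ b ∈ B, finrank K b = k)
    (h : ∀ T : Submodule K V, finrank K T = t + 1 → #{b ∈ B | T ≤ b} = lam) :
    ∃ μ, lam < μ ∧ ∀ L : Submodule K V, finrank K L = t → #{b ∈ B | L ≤ b} = μ := by
  classical
  have := Fintype.ofFinite K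
  have : Finite V := Module.finite_of_finite K
  have := Fintype.ofFinite V
  set q := Fintype.card K
  have hq : 1 < q := Fintype.one_lt_card
  have hlt : q ^ t < q ^ k := Nat.pow_lt_pow_right hq htk
  have hlt' : q ^ k < q ^ finrank K V := Nat.pow_lt_pow_right hq hkV
  have card_diff (L b : Submodule K V) (hL : finrank K L = t) (hLb : L ≤ b) :
      #{x | x ∈ b ∧ x ∉ L} = q ^ finrank K b - q ^ t := by
    have card_sub (W : Submodule K V) : #{x | x ∈ W} = q ^ finrank K W := by
      rw [← Module.card_eq_pow_finrank (K := K) (V := W), Fintype.card_subtype]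
    rw [← hL, ← card_sub, ← card_sub, ← card_sdiff_of_subset]
    · congr 1; ext x; simp
    · intro x; simpa using @hLb x
  have key (L : Submodule K V) (hL : finrank K L = t) :
      (q ^ finrank K V - q ^ t) * lam = #{b ∈ B | L ≤ b} * (q ^ k - q ^ t) := by
    rw [← finrank_top, ← card_diff L ⊤ hL le_top]
    refine card_mul_eq_card_mul (fun x b => x ∈ b) (fun x hx => ?_) (fun b hb => ?_)
    · have hx' : x ∉ L := by simpa using hx
      rw [← h (L ⊔ K ∙ x) (by rw [Submodule.finrank_sup_span_singleton hx', hL])]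
      simp [bipartiteAbove, filter_filter]
    · rw [mem_filter] at hb
      rw [← hB b hb.1, ← card_diff L b hL hb.2]
      congr 1; ext x; simp [bipartiteBelow, and_comm]
  obtain ⟨f, hf⟩ := exists_linearIndependent_of_le_finrank (htk.trans hkV).le
  have hL₀ : finrank K (Submodule.span K (Set.range f)) = t := by
    simpa using finrank_span_eq_card hf
  refine ⟨_, ?_, fun L hL => Nat.eq_of_mul_eq_mul_right (Nat.sub_pos_of_lt hlt)
    ((key L hL).symm.trans (key _ hL₀))⟩
  have e := key _ hL₀
  by_contra! hle
  have h1 := Nat.mul_le_mul_right (q ^ k - q ^ t) hle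
  rw [← e, mul_comm lam] at h1
  have := Nat.le_of_mul_le_mul_right h1 hlam
  omega

open Finset in
/-- Double counting of the triples `(b, R, S)` with `P, R, S ≤ b`. -/
theorem sum_card_filter_sup_le {α : Type*} [SemilatticeSup α] [DecidableLE α]
    (B X Y : Finset α) (P : α) :
    ∑ RS ∈ X ×ˢ Y, #{b ∈ B | P ⊔ RS.1 ⊔ RS.2 ≤ b} =
      ∑ b ∈ B with P ≤ b, #{R ∈ X | R ≤ b} * #{S ∈ Y | S ≤ b} := by
  have hl (RS : α × α) : {b ∈ B | P ⊔ RS.1 ⊔ RS.2 ≤ b} =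
      bipartiteAbove (fun RS b => RS.1 ≤ b ∧ RS.2 ≤ b) {b ∈ B | P ≤ b} RS := by
    ext b; simp [bipartiteAbove, and_assoc]
  simp_rw [hl]
  rw [sum_card_bipartiteAbove_eq_sum_card_bipartiteBelow]
  refine sum_congr rfl fun b _ => ?_
  rw [← card_product, bipartiteBelow, filter_product (fun R => R ≤ b) (fun S => S ≤ b)]

open Finset Module in
/-- If the span of three points determines the weight through its dimension, the weighted sum is
controlled by the numbers of triples of points spanning a space of dimension `1` and `2`. -/
theorem sum_eq_of_finrank_sup {K V : Type*} [Field K] [AddCommGroup V]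
    [Module K V] [Module.Finite K V] {X Y : Finset (Submodule K V)} {P : Submodule K V}
    (hP : finrank K P = 1) (hX : ∀ R ∈ X, finrank K R = 1) (hY : ∀ S ∈ Y, finrank K S = 1)
    {f : Submodule K V → ℕ} {a₁ a₂ a₃ : ℕ} (h₁ : ∀ L : Submodule K V, finrank K L = 1 → f L = a₁)
    (h₂ : ∀ L : Submodule K V, finrank K L = 2 → f L = a₂)
    (h₃ : ∀ L : Submodule K V, finrank K L = 3 → f L = a₃) :
    (∑ RS ∈ X ×ˢ Y, f (P ⊔ RS.1 ⊔ RS.2) : ℤ) = #X * #Y * a₃ +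
      (a₁ - a₃) * #{RS ∈ X ×ˢ Y | finrank K ↥(P ⊔ RS.1 ⊔ RS.2) = 1} +
      (a₂ - a₃) * #{RS ∈ X ×ˢ Y | finrank K ↥(P ⊔ RS.1 ⊔ RS.2) = 2} := by
  have hf : ∀ RS ∈ X ×ˢ Y, (f (P ⊔ RS.1 ⊔ RS.2) : ℤ) = a₃ +
      (a₁ - a₃) * (if finrank K ↥(P ⊔ RS.1 ⊔ RS.2) = 1 then 1 else 0) +
      (a₂ - a₃) * (if finrank K ↥(P ⊔ RS.1 ⊔ RS.2) = 2 then 1 else 0) := by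
    rintro ⟨R, S⟩ hRS
    rw [mem_product] at hRS
    have hR := hX R hRS.1
    have hS := hY S hRS.2
    have u₁ := Submodule.finrank_add_le_finrank_add_finrank (P ⊔ R) S
    have u₂ := Submodule.finrank_add_le_finrank_add_finrank P R
    have u₃ : finrank K P ≤ finrank K ↥(P ⊔ R ⊔ S) :=
      Submodule.finrank_mono (le_sup_left.trans le_sup_left)
    obtain h | h | h : finrank K ↥(P ⊔ R ⊔ S) = 1 ∨ finrank K ↥(P ⊔ R ⊔ S) = 2 ∨
        finrank K ↥(P ⊔ R ⊔ S) = 3 := by omega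
    · simp [h, h₁ _ h]
    · simp [h, h₂ _ h]
    · simp [h, h₃ _ h]
  rw [sum_congr rfl hf, sum_add_distrib, sum_add_distrib, ← mul_sum, ← mul_sum, sum_boole,
    sum_boole, sum_const, card_product]
  simp

open Finset Module in
/-- Only the pair `(P, P)` spans a `1`-dimensional space together with the point `P`. -/
theorem card_filter_finrank_sup_eq_one {K V : Type*} [Field K] [AddCommGroup V]
    [Module K V] [Module.Finite K V] [DecidableEq (Submodule K V)]
    {X Y : Finset (Submodule K V)} {P : Submodule K V}
    (hP : finrank K P = 1) (hX : ∀ R ∈ X, finrank K R = 1) (hY : ∀ S ∈ Y, finrank K S = 1) :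
    #{RS ∈ X ×ˢ Y | finrank K ↥(P ⊔ RS.1 ⊔ RS.2) = 1} = if P ∈ X ∧ P ∈ Y then 1 else 0 := by
  have hiff (RS) (hRS : RS ∈ X ×ˢ Y) : finrank K ↥(P ⊔ RS.1 ⊔ RS.2) = 1 ↔ RS = (P, P) := by
    obtain ⟨R, S⟩ := RS
    rw [mem_product] at hRS
    constructor
    · intro h
      have eP := Submodule.eq_of_le_of_finrank_eq (le_sup_left.trans le_sup_left : P ≤ P ⊔ R ⊔ S)
        (hP.trans h.symm)
      have eR := Submodule.eq_of_le_of_finrank_eq (le_sup_right.trans le_sup_left : R ≤ P ⊔ R ⊔ S)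
        ((hX R hRS.1).trans h.symm)
      have eS := Submodule.eq_of_le_of_finrank_eq (le_sup_right : S ≤ P ⊔ R ⊔ S)
        ((hY S hRS.2).trans h.symm)
      exact Prod.ext (eR.trans eP.symm) (eS.trans eP.symm)
    · rintro ⟨⟩
      rwa [show P ⊔ P ⊔ P = P by simp]
  rw [filter_congr hiff, filter_eq', apply_ite card]
  simp

/-- For a `3`-`(v,k,λ₃)_q` design with a tactical decomposition, the
value `Λ_rs(P)` is independent of the choice of the point `P ∈ V_l`. -/
theorem Lambda_independent_of_point
    (q v k l3 : ℕ) (Fq : Type) [Field Fq] [Fintype Fq]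
    (hq : Fintype.card Fq = q)
    (hvk : k < v) (hk : 1 < k) (hkt : 3 ≤ k) (hl3 : 1 ≤ l3)
    (B : Set (Submodule Fq (Fin v → Fq)))
    (hBdim : ∀ b ∈ B, Module.finrank Fq ↥b = k)
    (hdesign : ∀ T : Submodule Fq (Fin v → Fq), Module.finrank Fq ↥T = 3 →
      {b ∈ B | T ≤ b}.ncard = l3)
    (m n : ℕ)
    (Vc : Fin m → Set (Submodule Fq (Fin v → Fq)))
    (Bc : Fin n → Set (Submodule Fq (Fin v → Fq)))
    (hVpts : ∀ i, ∀ P ∈ Vc i, Module.finrank Fq ↥P = 1)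
    (hVpart : ∀ P : Submodule Fq (Fin v → Fq), Module.finrank Fq ↥P = 1 → ∃! i, P ∈ Vc i)
    (hBsub : ∀ j, Bc j ⊆ B)
    (hBpart : ∀ b ∈ B, ∃! j, b ∈ Bc j)
    (ρ κ : Fin m → Fin n → ℕ)
    (hρ : ∀ i j, ∀ P ∈ Vc i, {b ∈ Bc j | P ≤ b}.ncard = ρ i j)
    (hκ : ∀ i j, ∀ b ∈ Bc j, {P ∈ Vc i | P ≤ b}.ncard = κ i j) :
    ∀ l r s : Fin m, ∀ P ∈ Vc l, ∀ P' ∈ Vc l,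
      LambdaPt (Vc r) (Vc s) P = LambdaPt (Vc r) (Vc s) P' := by
  classical
  have := Fintype.ofFinite (Submodule Fq (Fin v → Fq))
  have hncard (s : Set (Submodule Fq (Fin v → Fq))) (p : Submodule Fq (Fin v → Fq) → Prop) :
      {x ∈ s | p x}.ncard = Finset.card {x ∈ s.toFinset | p x} := by
    rw [← Set.ncard_coe_finset]; congr 1; ext; simp
  have hv : Module.finrank Fq (Fin v → Fq) = v := by simp
  have hBdim' : ∀ b ∈ B.toFinset, Module.finrank Fq b = k := by simpa using hBdim
  simp only [hncard] at hdesign hρ hκ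
  obtain ⟨l2, hl2, hdesign₂⟩ := exists_card_filter_le_eq_of_finrank_succ (t := 2) (by omega)
    (by omega) hl3 hBdim' hdesign
  obtain ⟨l1, -, hdesign₁⟩ := exists_card_filter_le_eq_of_finrank_succ (t := 1) hk
    (by omega) (by omega) hBdim' hdesign₂
  intro l r s
  have hpts (i) : ∀ P ∈ (Vc i).toFinset, Module.finrank Fq P = 1 := by simpa using hVpts i
  have hLambda (P : Submodule Fq (Fin v → Fq)) : LambdaPt (Vc r) (Vc s) P =
      Finset.card {RS ∈ (Vc r).toFinset ×ˢ (Vc s).toFinset |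
        Module.finrank Fq ↥(P ⊔ RS.1 ⊔ RS.2) = 2} := by
    rw [LambdaPt, ← Set.ncard_coe_finset]; congr 1; ext; simp [and_assoc]
  have hclass (P) (hP : P ∈ Vc l) (i) : P ∈ Vc i ↔ l = i := by
    refine ⟨fun h => (hVpart P (hVpts l P hP)).unique hP h, ?_⟩
    rintro rfl
    exact hP
  have hsum (P) (hP : P ∈ Vc l) : ∑ RS ∈ (Vc r).toFinset ×ˢ (Vc s).toFinset,
      Finset.card {b ∈ B.toFinset | P ⊔ RS.1 ⊔ RS.2 ≤ b} = ∑ j, ρ l j * (κ r j * κ s j) := by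
    have hunion : ({b ∈ B.toFinset | P ≤ b} : Finset _) =
        Finset.univ.biUnion fun j => {b ∈ (Bc j).toFinset | P ≤ b} := by
      ext b
      simp only [Finset.mem_filter, Set.mem_toFinset, Finset.mem_biUnion, Finset.mem_univ, true_and]
      constructor
      · rintro ⟨hb, hPb⟩
        obtain ⟨j, hj, -⟩ := hBpart b hb
        exact ⟨j, hj, hPb⟩
      · rintro ⟨j, hj, hPb⟩
        exact ⟨hBsub j hj, hPb⟩
    rw [sum_card_filter_sup_le, hunion, Finset.sum_biUnion]
    · refine Finset.sum_congr rfl fun j _ => ?_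
      rw [Finset.sum_congr rfl (g := fun _ => κ r j * κ s j), Finset.sum_const,
        hρ l j P hP, smul_eq_mul]
      intro b hb
      have hb' : b ∈ Bc j := by simpa using (Finset.mem_filter.1 hb).1
      rw [hκ r j b hb', hκ s j b hb']
    · intro i _ j _ hij
      refine Finset.disjoint_left.2 fun b hbi hbj => hij ?_
      have hi : b ∈ Bc i := by simpa using (Finset.mem_filter.1 hbi).1
      have hj : b ∈ Bc j := by simpa using (Finset.mem_filter.1 hbj).1
      exact (hBpart b (hBsub i hi)).unique hi hj
  have hmain (P) (hP : P ∈ Vc l) := sum_eq_of_finrank_sup (hVpts l P hP) (hpts r) (hpts s)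
    (f := fun L => Finset.card {b ∈ B.toFinset | L ≤ b}) hdesign₁ hdesign₂ hdesign
  intro P hP P' hP'
  have e := hmain P hP
  have e' := hmain P' hP'
  rw [← Nat.cast_sum, hsum _ ‹_›, card_filter_finrank_sup_eq_one (hVpts l _ ‹_›) (hpts r) (hpts s),
    ← hLambda] at e e'
  simp only [Set.mem_toFinset, hclass _ hP, hclass _ hP'] at e e'
  rw [e] at e'
  have hne : (l2 - l3 : ℤ) ≠ 0 := by omega
  exact_mod_cast mul_left_cancel₀ hne (add_left_cancel e')
end

section
/- Let q be a prime power, V = F_q^v with v ≥ 2, and let P be a point (1-dimensional subspace) of V. Then the number of ordered pairs (R,S) of points of V such that dim⟨P,R,S⟩ = 2 equals q·(q+2)·(q^{v−1} − 1)/(q − 1). (In particular, for a 3-(v,k,λ_3)_q design whose automorphism group acts transitively on points, so that the point partition of the induced tactical decomposition has a single class, Λ_111 = q(q+2)·(q^{v−1} − 1)/(q − 1).) -/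
section

open Module

/-- The points of a subspace `W` are counted by the projectivization of `W`. -/
lemma Submodule.ncard_finrank_eq_one_and_le {K V : Type*} [Field K] [Finite K] [AddCommGroup V]
    [Module K V] (W : Submodule K V) {n : ℕ} (h : finrank K W = n) :
    {S : Submodule K V | finrank K S = 1 ∧ S ≤ W}.ncard =
      ∑ i ∈ Finset.range n, Nat.card K ^ i := by
  rw [← Projectivization.card_of_finrank K W h, ← Nat.card_coe_set_eq]
  refine (Nat.card_congr ((Projectivization.equivSubmodule K W).trans
    ((Equiv.subtypeEquiv (Submodule.MapSubtype.orderIso W).toEquiv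
      (q := fun S ↦ finrank K S.1 = 1) fun S ↦ ?_).trans
      ((Equiv.subtypeSubtypeEquivSubtypeInter (fun S ↦ S ≤ W)
        (fun S : Submodule K V ↦ finrank K S = 1)).trans
        (Equiv.subtypeEquivRight fun S ↦ and_comm))))).symm
  change _ ↔ finrank K (S.map W.subtype) = 1
  rw [LinearEquiv.finrank_eq (S.equivMapOfInjective _ W.injective_subtype)]

/-- Two distinct points span a line. -/
lemma Submodule.finrank_sup_eq_two_of_ne {K V : Type*} [Field K] [AddCommGroup V] [Module K V]
    [FiniteDimensional K V] {P R : Submodule K V} (hP : finrank K P = 1) (hR : finrank K R = 1)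
    (h : P ≠ R) : finrank K ↥(P ⊔ R) = 2 := by
  have hinf : finrank K ↥(P ⊓ R) < 1 := by
    by_contra! hge
    have h1 : P ⊓ R = P := Submodule.eq_of_le_of_finrank_le inf_le_left (by omega)
    have h2 : P ⊓ R = R := Submodule.eq_of_le_of_finrank_le inf_le_right (by omega)
    exact h (h1.symm.trans h2)
  have := Submodule.finrank_sup_add_finrank_inf_eq P R
  omega

/-- For points `P ≠ R`, a subspace `S` satisfies `dim ⟨P, R, S⟩ = 2` iff it lies on the line
through `P` and `R`. -/
lemma Submodule.finrank_sup_sup_eq_two_iff_le {K V : Type*} [Field K] [AddCommGroup V] [Module K V]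
    [FiniteDimensional K V] {P R S : Submodule K V} (hP : finrank K P = 1) (hR : finrank K R = 1)
    (h : P ≠ R) : finrank K ↥(P ⊔ R ⊔ S) = 2 ↔ S ≤ P ⊔ R := by
  have h2 := Submodule.finrank_sup_eq_two_of_ne hP hR h
  refine ⟨fun h3 ↦ ?_, fun h3 ↦ by rw [sup_eq_left.2 h3, h2]⟩
  have := Submodule.eq_of_le_of_finrank_le (le_sup_left : P ⊔ R ≤ P ⊔ R ⊔ S) (by omega)
  exact this ▸ le_sup_right

/-- For points `P` and `S`, `dim ⟨P, S⟩ = 2` iff `S ≠ P`. -/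
lemma Submodule.finrank_sup_eq_two_iff_ne {K V : Type*} [Field K] [AddCommGroup V] [Module K V]
    [FiniteDimensional K V] {P S : Submodule K V} (hP : finrank K P = 1) (hS : finrank K S = 1) :
    finrank K ↥(P ⊔ S) = 2 ↔ S ≠ P := by
  refine ⟨?_, fun h ↦ Submodule.finrank_sup_eq_two_of_ne hP hS h.symm⟩
  rintro h rfl
  rw [sup_idem] at h
  omega

end

/-- In `V = F_q^v` with `v ≥ 2`, for a fixed point `P` the number of
ordered pairs `(R,S)` of points with `dim ⟨P,R,S⟩ = 2` equals
`q(q+2)(q^{v−1} − 1)/(q − 1)`. -/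
theorem count_pairs_spanning_line_with_fixed_point
    (q v : ℕ) (Fq : Type) [Field Fq] [Fintype Fq]
    (hq : Fintype.card Fq = q) (hv : 2 ≤ v)
    (P : Submodule Fq (Fin v → Fq)) (hP : Module.finrank Fq ↥P = 1) :
    {RS : Submodule Fq (Fin v → Fq) × Submodule Fq (Fin v → Fq) |
        Module.finrank Fq ↥RS.1 = 1 ∧ Module.finrank Fq ↥RS.2 = 1 ∧
        Module.finrank Fq ↥(P ⊔ RS.1 ⊔ RS.2) = 2}.ncard =
      q * (q + 2) * ((q ^ (v - 1) - 1) / (q - 1)) := by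
  classical
  have := Fintype.ofFinite (Submodule Fq (Fin v → Fq))
  have hq2 : 2 ≤ q := hq ▸ Fintype.one_lt_card
  rw [← Nat.geomSum_eq hq2]
  set t := ∑ i ∈ Finset.range (v - 1), q ^ i with ht
  have points : {S : Submodule Fq (Fin v → Fq) | Module.finrank Fq S = 1}.ncard = q * t + 1 := by
    have h := Submodule.ncard_finrank_eq_one_and_le (⊤ : Submodule Fq (Fin v → Fq)) (n := v)
      (by simp)
    rw [ht, ← geom_sum_succ, Nat.sub_add_cancel (by omega)]
    simpa [hq] using h
  have others : {S : Submodule Fq (Fin v → Fq) | Module.finrank Fq S = 1 ∧ S ≠ P}.ncard =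
      q * t := by
    have h := Set.ncard_sdiff_singleton_add_one
      (s := {S : Submodule Fq (Fin v → Fq) | Module.finrank Fq S = 1}) hP
    rw [points] at h
    exact Nat.add_right_cancel h
  have fiber : ∀ R : Submodule Fq (Fin v → Fq),
      {S : Submodule Fq (Fin v → Fq) | Module.finrank Fq R = 1 ∧ Module.finrank Fq S = 1 ∧
        Module.finrank Fq ↥(P ⊔ R ⊔ S) = 2}.ncard =
      (if R = P then q * t else 0) +
        if Module.finrank Fq R = 1 ∧ R ≠ P then q + 1 else 0 := by
    intro R
    by_cases hR : Module.finrank Fq R = 1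
    · rcases eq_or_ne R P with rfl | hne
      · rw [if_pos rfl, if_neg (by simp), add_zero, ← others]
        congr 1
        ext S
        rw [Set.mem_ofPred_eq, Set.mem_ofPred_eq, sup_idem, and_iff_right hP]
        exact and_congr_right fun hS ↦ Submodule.finrank_sup_eq_two_iff_ne hP hS
      · rw [if_neg hne, if_pos ⟨hR, hne⟩, zero_add]
        simp only [hR, true_and, Submodule.finrank_sup_sup_eq_two_iff_le hP hR hne.symm]
        rw [Submodule.ncard_finrank_eq_one_and_le _
          (Submodule.finrank_sup_eq_two_of_ne hP hR hne.symm)]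
        simp [Finset.sum_range_succ, hq, add_comm]
    · have hne : R ≠ P := fun h ↦ hR (h ▸ hP)
      simp [hR, hne]
  simp only [Set.ncard_eq_toFinset_card', Set.toFinset_ofPred, Finset.card_filter] at others fiber ⊢
  rw [Fintype.sum_prod_type, Finset.sum_congr rfl fun R _ ↦ fiber R, Finset.sum_add_distrib,
    Finset.sum_ite_eq', if_pos (Finset.mem_univ _)]
  have hmul : ∀ R : Submodule Fq (Fin v → Fq),
      (if Module.finrank Fq R = 1 ∧ R ≠ P then q + 1 else 0) =
        (if Module.finrank Fq R = 1 ∧ R ≠ P then 1 else 0) * (q + 1) := by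
    intro R
    split_ifs <;> simp
  simp only [hmul]
  rw [← Finset.sum_mul, others]
  ring
end
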